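/- Let D be a finite distributive lattice whose greatest element is join-irreducible. Then Q = J⁺(D) is principal congruence representable. -/

import Mathlib

/-- A congruence of a lattice: an equivalence relation compatible with `⊔` and `⊓`. -/
structure LatCon (L : Type*) [Lattice L] where
  r : L → L → Prop
  refl : ∀ a, r a a
  symm : ∀ {a b}, r a b → r b a
  trans : ∀ {a b c}, r a b → r b c → r a c
  sup_comp : ∀ {a b c d}, r a b → r c d → r (a ⊔ c) (b ⊔ d)
  inf_comp : ∀ {a b c d}, r a b → r c d → r (a ⊓ c) (b ⊓ d)

namespace LatCon

variable {L : Type*} [Lattice L]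

theorem ext' {θ ψ : LatCon L} (h : ∀ a b, θ.r a b ↔ ψ.r a b) : θ = ψ := by
  cases θ; cases ψ
  simp only [mk.injEq]
  funext a b
  exact propext (h a b)

/-- Congruences are ordered by containment. -/
instance : PartialOrder (LatCon L) where
  le θ ψ := ∀ a b, θ.r a b → ψ.r a b
  le_refl θ := fun _ _ h => h
  le_trans θ ψ χ h1 h2 := fun a b h => h2 a b (h1 a b h)
  le_antisymm θ ψ h1 h2 := ext' fun a b => ⟨h1 a b, h2 a b⟩

instance : InfSet (LatCon L) where
  sInf S :=
    { r := fun a b => ∀ θ ∈ S, θ.r a b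
      refl := fun a θ _ => θ.refl a
      symm := fun h θ hθ => θ.symm (h θ hθ)
      trans := fun h1 h2 θ hθ => θ.trans (h1 θ hθ) (h2 θ hθ)
      sup_comp := fun h1 h2 θ hθ => θ.sup_comp (h1 θ hθ) (h2 θ hθ)
      inf_comp := fun h1 h2 θ hθ => θ.inf_comp (h1 θ hθ) (h2 θ hθ) }

/-- `Con L`, the lattice of congruences of `L`, is a complete lattice. -/
instance : CompleteLattice (LatCon L) :=
  completeLatticeOfInf (LatCon L) fun S =>
    ⟨fun θ hθ a b h => h θ hθ, fun ψ hψ a b h θ hθ => hψ hθ a b h⟩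

/-- The principal congruence `con(a, b)`: the smallest congruence collapsing `a` and `b`. -/
def princ (a b : L) : LatCon L := sInf {θ : LatCon L | θ.r a b}

/-- A congruence is principal if it is of the form `con(a, b)`. -/
def IsPrincipal (θ : LatCon L) : Prop := ∃ a b : L, θ = princ a b

end LatCon

/-- `Princ L`, the set of principal congruences of a lattice `L`,
ordered by containment (the order inherited from `Con L`). -/
def Princ (L : Type*) [Lattice L] : Set (LatCon L) := {θ : LatCon L | θ.IsPrincipal}

/-- `J⁺(D) = {⊥, ⊤} ∪ J(D)`, where `J(D)` is the set of join-irreducible elements. -/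
def Jplus (D : Type*) [Lattice D] [BoundedOrder D] : Set D :=
  {⊥, ⊤} ∪ {x : D | SupIrred x}

/-- `Q ⊆ D` is principal congruence representable: there are a finite lattice `L` and
an order isomorphism `φ : Con L ≃o D` mapping `Princ L` exactly onto `Q`. -/
def Representable (D : Type*) [Lattice D] (Q : Set D) : Prop :=
  ∃ (L : Type) (_ : Lattice L) (_ : Fintype L) (φ : LatCon L ≃o D),
    φ '' Princ L = Q

/-- `D` is fully representable: every candidate `J⁺(D) ⊆ Q ⊆ D` is representable. -/
def FullyRepresentable (D : Type*) [Lattice D] [BoundedOrder D] : Prop :=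
  ∀ Q : Set D, Jplus D ⊆ Q → Representable D Q

universe u


/-- Vertices are compatible when they are comparable elements of `ι`, or the same extra vertex. -/
def VertexCompat {ι : Type*} [LE ι] : ι ⊕ Fin 3 → ι ⊕ Fin 3 → Prop
  | .inl p, .inl q => p ≤ q ∨ q ≤ p
  | .inr i, .inr j => i = j
  | _, _ => False

/-- A set of pairwise compatible vertices. -/
def IsVertexClique {ι : Type*} [LE ι] (A : Set (ι ⊕ Fin 3)) : Prop :=
  ∀ v ∈ A, ∀ w ∈ A, VertexCompat v w

/-- A clique of vertices (a chain of `ι`, or an extra vertex) together with a lower subset of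
marked elements of the clique; one more element, with everything marked, is added on top. -/
@[ext]
structure MarkedClique (ι : Type*) [LE ι] where
  supp : Set (ι ⊕ Fin 3)
  mark : Set ι
  valid : (IsVertexClique supp ∧ (∀ p ∈ mark, Sum.inl p ∈ supp) ∧
      ∀ p ∈ mark, ∀ q, Sum.inl q ∈ supp → q ≤ p → q ∈ mark) ∨
    (supp = Set.univ ∧ mark = Set.univ)

namespace MarkedClique

variable {ι : Type*} [PartialOrder ι]

theorem not_isVertexClique_univ : ¬ IsVertexClique (Set.univ : Set (ι ⊕ Fin 3)) := fun h => by
  have h01 := h (.inr 0) trivial (.inr 1) trivial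
  simp [VertexCompat] at h01

theorem inl_mem_supp (a : MarkedClique ι) {p : ι} (hp : p ∈ a.mark) : Sum.inl p ∈ a.supp := by
  rcases a.valid with h | h
  · exact h.2.1 p hp
  · simp [h.1]

theorem mem_mark_of_le (a : MarkedClique ι) {p q : ι} (hp : p ∈ a.mark)
    (hq : Sum.inl q ∈ a.supp) (hqp : q ≤ p) : q ∈ a.mark := by
  rcases a.valid with h | h
  · exact h.2.2 p hp q hq hqp
  · simp [h.2]

instance : PartialOrder (MarkedClique ι) where
  le a b := a.supp ⊆ b.supp ∧ a.mark ⊆ b.mark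
  le_refl _ := ⟨subset_rfl, subset_rfl⟩
  le_trans _ _ _ h₁ h₂ := ⟨h₁.1.trans h₂.1, h₁.2.trans h₂.2⟩
  le_antisymm _ _ h₁ h₂ :=
    MarkedClique.ext (h₁.1.antisymm h₂.1) (h₁.2.antisymm h₂.2)

instance : BoundedOrder (MarkedClique ι) where
  top := ⟨Set.univ, Set.univ, .inr ⟨rfl, rfl⟩⟩
  bot := ⟨∅, ∅, .inl ⟨by simp [IsVertexClique], by simp, by simp⟩⟩
  le_top _ := ⟨Set.subset_univ _, Set.subset_univ _⟩
  bot_le _ := ⟨Set.empty_subset _, Set.empty_subset _⟩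

@[simp] theorem supp_top : (⊤ : MarkedClique ι).supp = Set.univ := rfl
@[simp] theorem mark_top : (⊤ : MarkedClique ι).mark = Set.univ := rfl
@[simp] theorem supp_bot : (⊥ : MarkedClique ι).supp = ∅ := rfl
@[simp] theorem mark_bot : (⊥ : MarkedClique ι).mark = ∅ := rfl

theorem eq_top_of_not_isVertexClique {a : MarkedClique ι} (h : ¬ IsVertexClique a.supp) :
    a = ⊤ := by
  rcases a.valid with h' | h'
  · exact absurd h'.1 h
  · exact MarkedClique.ext h'.1 h'.2

/-- The meet is given by intersection. -/
def inter (a b : MarkedClique ι) : MarkedClique ι where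
  supp := a.supp ∩ b.supp
  mark := a.mark ∩ b.mark
  valid := by
    by_cases ha : IsVertexClique a.supp
    · exact .inl ⟨fun v hv w hw => ha v hv.1 w hw.1,
        fun p hp => ⟨a.inl_mem_supp hp.1, b.inl_mem_supp hp.2⟩,
        fun p hp q hq hqp => ⟨a.mem_mark_of_le hp.1 hq.1 hqp, b.mem_mark_of_le hp.2 hq.2 hqp⟩⟩
    · have hb := b.valid
      rw [eq_top_of_not_isVertexClique ha]
      simpa using hb

open Classical in
/-- The join is the union with the marks closed downwards if the union is a clique, and the top
element otherwise. -/
noncomputable def union (a b : MarkedClique ι) : MarkedClique ι :=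
  if h : IsVertexClique (a.supp ∪ b.supp) then
    { supp := a.supp ∪ b.supp
      mark := {q | Sum.inl q ∈ a.supp ∪ b.supp ∧ ∃ p ∈ a.mark ∪ b.mark, q ≤ p}
      valid := .inl ⟨h, fun _ hp => hp.1,
        fun _ hp _ hq hqp => ⟨hq, hp.2.imp fun _ hr => ⟨hr.1, hqp.trans hr.2⟩⟩⟩ }
  else ⊤

theorem left_le_union (a b : MarkedClique ι) : a ≤ union a b := by
  unfold union
  split_ifs with h
  · exact ⟨Set.subset_union_left,
      fun p hp => ⟨.inl (a.inl_mem_supp hp), p, .inl hp, le_rfl⟩⟩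
  · exact le_top

theorem right_le_union (a b : MarkedClique ι) : b ≤ union a b := by
  unfold union
  split_ifs with h
  · exact ⟨Set.subset_union_right,
      fun p hp => ⟨.inr (b.inl_mem_supp hp), p, .inr hp, le_rfl⟩⟩
  · exact le_top

theorem union_le {a b c : MarkedClique ι} (hac : a ≤ c) (hbc : b ≤ c) : union a b ≤ c := by
  have hs := Set.union_subset hac.1 hbc.1
  by_cases hc : IsVertexClique c.supp
  · have h : IsVertexClique (a.supp ∪ b.supp) := fun v hv w hw => hc v (hs hv) w (hs hw)
    rw [union, dif_pos h]
    exact ⟨hs, fun q ⟨hq, p, hp, hqp⟩ =>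
      c.mem_mark_of_le (Set.union_subset hac.2 hbc.2 hp) (hs hq) hqp⟩
  · rw [eq_top_of_not_isVertexClique hc]
    exact le_top

noncomputable instance : Lattice (MarkedClique ι) where
  sup := union
  le_sup_left := left_le_union
  le_sup_right := right_le_union
  sup_le _ _ _ := union_le
  inf := inter
  inf_le_left _ _ := ⟨Set.inter_subset_left, Set.inter_subset_left⟩
  inf_le_right _ _ := ⟨Set.inter_subset_right, Set.inter_subset_right⟩
  le_inf _ _ _ h₁ h₂ := ⟨Set.subset_inter h₁.1 h₂.1, Set.subset_inter h₁.2 h₂.2⟩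

@[simp] theorem supp_inf (a b : MarkedClique ι) : (a ⊓ b).supp = a.supp ∩ b.supp := rfl
@[simp] theorem mark_inf (a b : MarkedClique ι) : (a ⊓ b).mark = a.mark ∩ b.mark := rfl

theorem sup_eq_union (a b : MarkedClique ι) : a ⊔ b = union a b := rfl

theorem sup_eq_top {a b : MarkedClique ι} (h : ¬ IsVertexClique (a.supp ∪ b.supp)) :
    a ⊔ b = ⊤ := dif_neg h

theorem supp_sup {a b : MarkedClique ι} (h : IsVertexClique (a.supp ∪ b.supp)) :
    (a ⊔ b).supp = a.supp ∪ b.supp := by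
  rw [sup_eq_union, union, dif_pos h]

theorem mark_sup {a b : MarkedClique ι} (h : IsVertexClique (a.supp ∪ b.supp)) :
    (a ⊔ b).mark = {q | Sum.inl q ∈ a.supp ∪ b.supp ∧ ∃ p ∈ a.mark ∪ b.mark, q ≤ p} := by
  rw [sup_eq_union, union, dif_pos h]

instance [Finite ι] : Finite (MarkedClique ι) :=
  Finite.of_injective (fun a => (a.supp, a.mark)) fun _ _ h =>
    MarkedClique.ext (congrArg Prod.fst h) (congrArg Prod.snd h)

/-- A single unmarked vertex. -/
def vertex (v : ι ⊕ Fin 3) : MarkedClique ι where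
  supp := {v}
  mark := ∅
  valid := .inl ⟨by rcases v with p | i <;> simp [IsVertexClique, VertexCompat], by simp, by simp⟩

/-- A single marked vertex. -/
def marked (p : ι) : MarkedClique ι where
  supp := {.inl p}
  mark := {p}
  valid := .inl ⟨by simp [IsVertexClique, VertexCompat], by simp, by simp⟩

@[simp] theorem supp_vertex (v : ι ⊕ Fin 3) : (vertex v).supp = {v} := rfl
@[simp] theorem mark_vertex (v : ι ⊕ Fin 3) : (vertex v).mark = ∅ := rfl
@[simp] theorem supp_marked (p : ι) : (marked p).supp = {.inl p} := rfl
@[simp] theorem mark_marked (p : ι) : (marked p).mark = {p} := rfl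

theorem inf_vertex_of_mem {a : MarkedClique ι} {v : ι ⊕ Fin 3} (h : v ∈ a.supp) :
    a ⊓ vertex v = vertex v :=
  inf_eq_right.2 ⟨by simpa using h, by simp⟩

theorem inf_vertex_of_notMem {a : MarkedClique ι} {v : ι ⊕ Fin 3} (h : v ∉ a.supp) :
    a ⊓ vertex v = ⊥ :=
  MarkedClique.ext (by simpa using h) (by simp)

theorem vertex_sup_vertex {v w : ι ⊕ Fin 3} (h : ¬ VertexCompat v w) :
    vertex v ⊔ vertex w = ⊤ :=
  sup_eq_top fun h' => h (h' v (by simp) w (by simp))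

/-- Two distinct elements with the same support are comparable, and the greatest mark of the
larger one is not a mark of the smaller one. -/
theorem exists_greatest_mark [Finite ι] {a b : MarkedClique ι} (hs : a.supp = b.supp)
    (hne : a ≠ b) :
    (a ≤ b ∧ ∃ p ∈ b.mark, p ∉ a.mark ∧ ∀ q ∈ b.mark, q ≤ p) ∨
      (b ≤ a ∧ ∃ p ∈ a.mark, p ∉ b.mark ∧ ∀ q ∈ a.mark, q ≤ p) := by
  have hc : IsVertexClique a.supp := by
    by_contra hc
    exact hne ((eq_top_of_not_isVertexClique hc).trans
      (eq_top_of_not_isVertexClique (hs ▸ hc)).symm)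
  have greatest : ∀ c d : MarkedClique ι, c.supp = d.supp → IsVertexClique d.supp → c ≠ d →
      c.mark ⊆ d.mark → c ≤ d ∧ ∃ p ∈ d.mark, p ∉ c.mark ∧ ∀ q ∈ d.mark, q ≤ p := by
    intro c d hcd hd hne hsub
    obtain ⟨r, hr, hrc⟩ : ∃ r ∈ d.mark, r ∉ c.mark := by
      by_contra! h
      exact hne (MarkedClique.ext hcd (hsub.antisymm h))
    obtain ⟨p, hp, hmax⟩ := (Set.toFinite d.mark).exists_maximal ⟨r, hr⟩
    have hle : ∀ q ∈ d.mark, q ≤ p := fun q hq =>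
      (hd _ (d.inl_mem_supp hq) _ (d.inl_mem_supp hp)).elim id fun h => hmax hq h
    exact ⟨⟨hcd.le, hsub⟩, p, hp,
      fun hpc => hrc (c.mem_mark_of_le hpc (hcd ▸ d.inl_mem_supp hr) (hle r hr)), hle⟩
  by_cases hab : a.mark ⊆ b.mark
  · exact .inl (greatest a b hs (hs ▸ hc) hne hab)
  · refine .inr (greatest b a hs.symm hc hne.symm fun q hq => ?_)
    obtain ⟨p, hp, hpb⟩ := Set.not_subset.1 hab
    have hqs : Sum.inl q ∈ a.supp := hs ▸ b.inl_mem_supp hq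
    rcases hc _ (a.inl_mem_supp hp) _ hqs with h | h
    · exact absurd (b.mem_mark_of_le hq (hs ▸ a.inl_mem_supp hp) h) hpb
    · exact a.mem_mark_of_le hp hqs h

/-- The congruence that ignores the marks in the lower set `S`, or identifies everything if `t`
holds. -/
def latCon (t : Prop) (S : LowerSet ι) : LatCon (MarkedClique ι) where
  r a b := t ∨ (a.supp = b.supp ∧ ∀ p ∉ S, p ∈ a.mark ↔ p ∈ b.mark)
  refl _ := .inr ⟨rfl, fun _ _ => Iff.rfl⟩
  symm h := h.imp_right fun h => ⟨h.1.symm, fun p hp => (h.2 p hp).symm⟩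
  trans h₁ h₂ := h₁.elim .inl fun h₁ => h₂.imp_right fun h₂ =>
    ⟨h₁.1.trans h₂.1, fun p hp => (h₁.2 p hp).trans (h₂.2 p hp)⟩
  sup_comp {a b c d} h₁ h₂ := h₁.elim .inl fun h₁ => h₂.imp_right fun h₂ => by
    have hs : a.supp ∪ c.supp = b.supp ∪ d.supp := by rw [h₁.1, h₂.1]
    by_cases hc : IsVertexClique (a.supp ∪ c.supp)
    · have hc' : IsVertexClique (b.supp ∪ d.supp) := hs ▸ hc
      refine ⟨by rw [supp_sup hc, supp_sup hc', hs], fun p hp => ?_⟩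
      rw [mark_sup hc, mark_sup hc', hs]
      refine and_congr_right fun _ => exists_congr fun q => and_congr_left fun hpq => ?_
      have hq : q ∉ S := fun hq => hp (S.lower hpq hq)
      exact or_congr (h₁.2 q hq) (h₂.2 q hq)
    · rw [sup_eq_top hc, sup_eq_top (hs ▸ hc)]
      exact ⟨rfl, fun _ _ => Iff.rfl⟩
  inf_comp {a b c d} h₁ h₂ := h₁.elim .inl fun h₁ => h₂.imp_right fun h₂ =>
    ⟨by rw [supp_inf, supp_inf, h₁.1, h₂.1],
      fun p hp => and_congr (h₁.2 p hp) (h₂.2 p hp)⟩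

theorem latCon_r {t : Prop} {S : LowerSet ι} {a b : MarkedClique ι} :
    (latCon t S).r a b ↔
      t ∨ (a.supp = b.supp ∧ ∀ p ∉ S, p ∈ a.mark ↔ p ∈ b.mark) := Iff.rfl

theorem latCon_vertex_marked {t : Prop} {S : LowerSet ι} {p : ι} :
    (latCon t S).r (vertex (.inl p)) (marked p) ↔ t ∨ p ∈ S := by
  simp only [latCon_r, supp_vertex, supp_marked, mark_vertex, mark_marked, true_and,
    Set.mem_empty_iff_false, false_iff, Set.mem_singleton_iff]
  exact or_congr_right ⟨fun h => by_contra fun hp => h p hp rfl, fun h q hq hqp => hq (hqp ▸ h)⟩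

section Congruence

variable {θ : LatCon (MarkedClique ι)}

theorem rel_of_rel_vertex_bot {v : ι ⊕ Fin 3} (h : θ.r (vertex v) ⊥) (a b : MarkedClique ι) :
    θ.r a b := by
  obtain ⟨i, j, hi, hj, hij⟩ : ∃ i j : Fin 3, ¬ VertexCompat v (.inr i) ∧
      ¬ VertexCompat v (.inr j) ∧ ¬ VertexCompat (ι := ι) (.inr i) (.inr j) := by
    rcases v with p | k
    · exact ⟨0, 1, by simp [VertexCompat]⟩
    · refine ⟨k + 1, k + 2, ?_⟩
      simp only [VertexCompat]
      clear h
      revert k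
      decide
  have h₁ : θ.r ⊤ (vertex (.inr i)) := by
    simpa [vertex_sup_vertex hi] using θ.sup_comp h (θ.refl (vertex (.inr i)))
  have hne : (Sum.inr j : ι ⊕ Fin 3) ∉ (vertex (.inr i) : MarkedClique ι).supp := by
    intro hji
    rw [supp_vertex, Set.mem_singleton_iff] at hji
    rw [hji] at hij
    exact hij rfl
  have h₂ : θ.r (vertex (.inr j)) ⊥ := by
    simpa [inf_vertex_of_notMem hne] using θ.inf_comp h₁ (θ.refl (vertex (.inr j)))
  have h₃ : θ.r ⊤ ⊥ := by
    simpa [vertex_sup_vertex hj] using θ.sup_comp h h₂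
  have h₄ : ∀ c, θ.r c ⊥ := fun c => by simpa using θ.inf_comp (θ.refl c) h₃
  exact θ.trans (h₄ a) (θ.symm (h₄ b))

theorem rel_of_rel_of_supp_ne {c d : MarkedClique ι} (h : θ.r c d) (hs : c.supp ≠ d.supp)
    (a b : MarkedClique ι) : θ.r a b := by
  have key : ∀ c d : MarkedClique ι, θ.r c d → ∀ v ∈ c.supp, v ∉ d.supp → θ.r a b := by
    intro c d h v hc hd
    have := θ.inf_comp h (θ.refl (vertex v))
    rw [inf_vertex_of_mem hc, inf_vertex_of_notMem hd] at this
    exact rel_of_rel_vertex_bot this a b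
  by_contra hab
  exact hs (Set.Subset.antisymm
    (fun v hc => by_contra fun hd => hab (key c d h v hc hd))
    (fun v hd => by_contra fun hc => hab (key d c (θ.symm h) v hd hc)))

theorem rel_vertex_marked_of_mem {a b : MarkedClique ι} (h : θ.r a b) {p : ι}
    (ha : p ∈ a.mark) (hs : a.supp = b.supp) (hb : p ∉ b.mark) :
    θ.r (vertex (.inl p)) (marked p) := by
  have hpa := a.inl_mem_supp ha
  have h₁ : a ⊓ marked p = marked p := inf_eq_right.2 ⟨by simpa using hpa, by simpa using ha⟩
  have h₂ : b ⊓ marked p = vertex (.inl p) :=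
    MarkedClique.ext (by simpa using hs ▸ hpa) (by simpa using hb)
  have := θ.inf_comp h (θ.refl (marked p))
  rw [h₁, h₂] at this
  exact θ.symm this

theorem rel_vertex_marked_of_le {p q : ι} (hqp : q ≤ p)
    (h : θ.r (vertex (.inl p)) (marked p)) : θ.r (vertex (.inl q)) (marked q) := by
  have hc : IsVertexClique ((vertex (.inl p) : MarkedClique ι).supp ∪
      (vertex (.inl q) : MarkedClique ι).supp) := by
    simp [IsVertexClique, VertexCompat, hqp]
  have hc' : IsVertexClique ((marked p).supp ∪ (vertex (.inl q) : MarkedClique ι).supp) := hc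
  refine rel_vertex_marked_of_mem (θ.symm (θ.sup_comp h (θ.refl (vertex (.inl q))))) ?_ ?_ ?_
  · rw [mark_sup hc']
    simp [hqp]
  · rw [supp_sup hc, supp_sup hc']
    simp
  · rw [mark_sup hc]
    simp

/-- The elements of `ι` whose marks are ignored by `θ`. -/
def ignored (θ : LatCon (MarkedClique ι)) : LowerSet ι where
  carrier := {p | θ.r (vertex (.inl p)) (marked p)}
  lower' _ _ hqp h := rel_vertex_marked_of_le hqp h

theorem rel_of_greatest_mark {a b : MarkedClique ι} {p : ι} (hab : a ≤ b)
    (hs : a.supp = b.supp) (hp : p ∈ b.mark) (hle : ∀ q ∈ b.mark, q ≤ p)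
    (h : θ.r (vertex (.inl p)) (marked p)) : θ.r a b := by
  have hpb := b.inl_mem_supp hp
  have h₁ : a ⊔ vertex (.inl p) = a :=
    sup_eq_left.2 ⟨by simpa [hs] using hpb, by simp⟩
  have h₂ : a ⊔ marked p = b := by
    refine le_antisymm (sup_le hab ⟨by simpa using hpb, by simpa using hp⟩) ?_
    have hsub : b.supp ⊆ (a ⊔ marked p).supp := hs ▸ (le_sup_left : a ≤ a ⊔ marked p).1
    exact ⟨hsub, fun q hq => mem_mark_of_le _
      ((le_sup_right : marked p ≤ a ⊔ marked p).2 (Set.mem_singleton p))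
      (hsub (b.inl_mem_supp hq)) (hle q hq)⟩
  simpa [h₁, h₂] using θ.sup_comp (θ.refl a) h

theorem eq_latCon [Finite ι] (θ : LatCon (MarkedClique ι)) :
    θ = latCon (∀ a b, θ.r a b) (ignored θ) := by
  refine LatCon.ext' fun a b => ⟨fun h => ?_, fun h => ?_⟩
  · by_cases hs : a.supp = b.supp
    · exact .inr ⟨hs, fun p hp =>
        ⟨fun ha => by_contra fun hb => hp (rel_vertex_marked_of_mem h ha hs hb),
        fun hb => by_contra fun ha => hp (rel_vertex_marked_of_mem (θ.symm h) hb hs.symm ha)⟩⟩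
    · exact .inl (rel_of_rel_of_supp_ne h hs)
  · rcases h with h | ⟨hs, h⟩
    · exact h a b
    by_cases hne : a = b
    · exact hne ▸ θ.refl a
    rcases exists_greatest_mark hs hne with ⟨hab, p, hp, hpa, hle⟩ | ⟨hab, p, hp, hpa, hle⟩
    · exact rel_of_greatest_mark hab hs hp hle
        (by_contra fun hS => hpa ((h p hS).2 hp))
    · exact θ.symm (rel_of_greatest_mark hab hs.symm hp hle
        (by_contra fun hS => hpa ((h p hS).1 hp)))

end Congruence

end MarkedClique

theorem le_of_forall_supIrred_le {α : Type*} [DistribLattice α] [OrderBot α] [Finite α]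
    {a b : α} (h : ∀ p, SupIrred p → p ≤ a → p ≤ b) : a ≤ b := by
  obtain ⟨s, rfl, hs⟩ := exists_supIrred_decomposition a
  exact Finset.sup_le fun p hp => h p (hs hp) (Finset.le_sup (f := id) hp)

namespace LatCon

theorem princ_le_iff {L : Type*} [Lattice L] {a b : L} {θ : LatCon L} :
    princ a b ≤ θ ↔ θ.r a b :=
  ⟨fun h => h a b fun _ hψ => hψ, fun h => sInf_le h⟩

end LatCon

open MarkedClique in
/-- If the join-irreducible elements below the top are indexed by a poset `ι` in the lowest
universe, then the lattice of marked cliques of `ι` represents `Jplus D`. -/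
theorem representable_Jplus_of_labelling {D : Type*} [DistribLattice D] [Fintype D]
    [BoundedOrder D] (h : SupIrred (⊤ : D)) {ι : Type} [Finite ι] [PartialOrder ι] (f : ι ↪o D)
    (hf : ∀ p, (∃ i, f i = p) ↔ SupIrred p ∧ p ≠ ⊤) : Representable D (Jplus D) := by
  classical
  let below (d : D) : LowerSet ι := ⟨{i | f i ≤ d}, fun i j hji hi => (f.monotone hji).trans hi⟩
  let g (d : D) : LatCon (MarkedClique ι) := latCon (d = ⊤) (below d)
  have g_atom : ∀ d i, (g d).r (vertex (.inl i)) (marked i) ↔ f i ≤ d := fun d i =>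
    latCon_vertex_marked.trans (or_iff_right_of_imp fun hd => hd ▸ le_top)
  have g_le : ∀ d d', g d ≤ g d' ↔ d ≤ d' := by
    refine fun d d' => ⟨fun hle => ?_, fun hle a b hab => ?_⟩
    · by_cases hd : d = ⊤
      · rcases hle ⊥ ⊤ (.inl hd) with h' | h'
        · exact h' ▸ le_top
        · exact absurd h'.1 Set.empty_ne_univ
      · refine le_of_forall_supIrred_le fun p hp hpd => ?_
        obtain ⟨i, rfl⟩ := (hf p).2 ⟨hp, fun hp' => hd (top_le_iff.1 (hp' ▸ hpd))⟩
        exact (g_atom d' i).1 (hle _ _ ((g_atom d i).2 hpd))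
    · rcases hab with hd | hab
      · exact .inl (top_le_iff.1 (hd ▸ hle))
      · exact .inr ⟨hab.1, fun p hp => hab.2 p fun hpd => hp (le_trans hpd hle)⟩
  have g_surj : Function.Surjective g := by
    intro θ
    by_cases hθ : ∀ a b, θ.r a b
    · exact ⟨⊤, LatCon.ext' fun a b => ⟨fun _ => hθ a b, fun _ => .inl rfl⟩⟩
    let s : Finset D := {d | ∃ i ∈ ignored θ, f i = d}
    have hs : ∀ p, SupIrred p → p ≤ s.sup id → ∃ i ∈ ignored θ, p ≤ f i := by
      intro p hp hps
      obtain ⟨q, hq, hpq⟩ := hp.supPrime.le_finset_sup.1 hps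
      obtain ⟨i, hi, rfl⟩ := (Finset.mem_filter.1 hq).2
      exact ⟨i, hi, hpq⟩
    refine ⟨s.sup id, ?_⟩
    have htop : s.sup id ≠ ⊤ := by
      intro htop
      obtain ⟨i, -, hi⟩ := hs ⊤ h htop.ge
      exact ((hf (f i)).1 ⟨i, rfl⟩).2 (top_le_iff.1 hi)
    have hbelow : below (s.sup id) = ignored θ := by
      ext i
      refine ⟨fun hi => ?_, fun hi => ?_⟩
      · obtain ⟨j, hj, hij⟩ := hs (f i) ((hf (f i)).1 ⟨i, rfl⟩).1 hi
        exact (ignored θ).lower (f.le_iff_le.1 hij) hj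
      · exact Finset.le_sup (f := id) (Finset.mem_filter.2 ⟨Finset.mem_univ _, i, hi, rfl⟩)
    rw [eq_latCon θ]
    simp only [g, hbelow]
    congr 1
    simp [htop, hθ]
  let e : D ≃o LatCon (MarkedClique ι) :=
    RelIso.ofSurjective (OrderEmbedding.ofMapLEIff g g_le) g_surj
  have g_eq_princ : ∀ d a b, (∀ d', (g d').r a b ↔ d ≤ d') → g d = LatCon.princ a b := by
    refine fun d a b hd => eq_of_forall_ge_iff fun θ => ?_
    obtain ⟨d', rfl⟩ := g_surj θ
    rw [g_le, LatCon.princ_le_iff, hd]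
  have g_of_greatest : ∀ a b : MarkedClique ι, a ≤ b → a.supp = b.supp →
      ∀ i ∈ b.mark, i ∉ a.mark → (∀ j ∈ b.mark, j ≤ i) → ∀ d, (g d).r a b ↔ f i ≤ d := by
    intro a b hab hs i hi hia hle d
    rw [← g_atom]
    exact ⟨fun h' => rel_vertex_marked_of_mem ((g d).symm h') hi hs.symm hia,
      rel_of_greatest_mark hab hs hi hle⟩
  have supIrred_f : ∀ i, SupIrred (f i) := fun i => ((hf (f i)).1 ⟨i, rfl⟩).1
  have g_of_supp_ne : ∀ a b : MarkedClique ι, a.supp ≠ b.supp →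
      ∀ d, (g d).r a b ↔ ⊤ ≤ d := fun a b hs d =>
    (or_iff_left fun h' => hs h'.1).trans top_le_iff.symm
  have top_mem : g ⊤ ∈ Princ (MarkedClique ι) :=
    ⟨⊥, ⊤, g_eq_princ _ _ _ (g_of_supp_ne _ _ Set.empty_ne_univ)⟩
  refine ⟨MarkedClique ι, inferInstance, Fintype.ofFinite _, e.symm, ?_⟩
  ext d
  rw [show e.symm '' Princ (MarkedClique ι) = e ⁻¹' Princ (MarkedClique ι) from
    e.symm.toEquiv.image_eq_preimage_symm _]
  constructor
  · rintro ⟨a, b, hab : g d = _⟩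
    have of_eq : ∀ d', (∀ d'', (g d'').r a b ↔ d' ≤ d'') → d = d' := fun d' hd' =>
      e.injective (hab.trans (g_eq_princ d' a b hd').symm)
    by_cases hs : a.supp = b.supp
    · by_cases hne : a = b
      · exact .inl (.inl (of_eq ⊥ fun d' => iff_of_true (hne ▸ (g d').refl a) bot_le))
      right
      rcases exists_greatest_mark hs hne with ⟨hab, i, hi, hia, hle⟩ | ⟨hab, i, hi, hia, hle⟩
      · rw [of_eq (f i) (g_of_greatest a b hab hs i hi hia hle)]
        exact supIrred_f i
      · rw [of_eq (f i) fun d' => ⟨fun h' => (g_of_greatest b a hab hs.symm i hi hia hle d').1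
          ((g d').symm h'), fun h' => (g d').symm
          ((g_of_greatest b a hab hs.symm i hi hia hle d').2 h')⟩]
        exact supIrred_f i
    · exact .inl (.inr (of_eq ⊤ (g_of_supp_ne a b hs)))
  · rintro ((rfl | rfl) | hd)
    · exact ⟨⊥, ⊥, g_eq_princ _ _ _ fun d' => iff_of_true ((g d').refl _) bot_le⟩
    · exact top_mem
    · by_cases htop : d = ⊤
      · exact htop ▸ top_mem
      · obtain ⟨i, rfl⟩ := (hf d).2 ⟨hd, htop⟩
        exact ⟨_, _, g_eq_princ _ _ _ fun d' => g_atom d' i⟩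

/-- **Theorem 3.** If `D` is a finite distributive lattice whose unit element is
join-irreducible, then `Q = J⁺(D)` is principal congruence representable. -/
theorem Jplus_representable_of_supIrred_top
    (D : Type*) [DistribLattice D] [Fintype D] [BoundedOrder D]
    (h : SupIrred (⊤ : D)) :
    Representable D (Jplus D) := by
  obtain ⟨n, ⟨k⟩⟩ := Finite.exists_equiv_fin {p : D // SupIrred p ∧ p ≠ ⊤}
  let : PartialOrder (Fin n) := PartialOrder.lift (fun i => (k.symm i : D))
    (Subtype.val_injective.comp k.symm.injective)
  refine representable_Jplus_of_labelling h
    (OrderEmbedding.ofMapLEIff (fun i : Fin n => (k.symm i : D)) fun _ _ => Iff.rfl) fun p => ?_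
  exact ⟨fun ⟨i, hi⟩ => hi ▸ (k.symm i).2, fun hp => ⟨k ⟨p, hp⟩, by simp⟩⟩
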